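/- arXiv:1611.00115 — 2 statements merged into one kernel-verified Lean document; each statement's English description precedes it below -/
import Mathlib

section
/- Let W_{(α,β)} = (T₁,T₂) be a commuting 2-variable weighted shift with positive weights. Then its spherical Aluthge transform Ŵ_{(α,β)} = (T̂₁,T̂₂) is always a commuting pair, i.e., T̂₁T̂₂ = T̂₂T̂₁. -/
open scoped ComplexOrder
open MeasureTheory ContinuousLinearMap

noncomputable section

/-- The Hilbert space `ℓ²(ℤ₊²)`. -/
abbrev H2 : Type := lp (fun _ : ℕ × ℕ => ℂ) 2

/-- The canonical orthonormal basis vectors of `ℓ²(ℤ₊²)`. -/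
noncomputable def e2 (k : ℕ × ℕ) : H2 := lp.single 2 k 1

/-- Bounded operators on `ℓ²(ℤ₊²)` that agree on the canonical basis are equal. -/
theorem ext_e2 {A B : H2 →L[ℂ] H2} (h : ∀ k, A (e2 k) = B (e2 k)) : A = B := by
  refine lp.ext_continuousLinearMap (by norm_num) fun k => ?_
  ext
  simpa [e2] using congrArg (fun v : H2 => v _) (h k)

/-- The weights of a commuting 2-variable weighted shift satisfy the compatibility relation. -/
theorem weights_comm_of_comm {α β : ℕ × ℕ → ℝ} {T₁ T₂ : H2 →L[ℂ] H2}
    (hT₁ : ∀ k : ℕ × ℕ, T₁ (e2 k) = (α k : ℂ) • e2 (k.1 + 1, k.2))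
    (hT₂ : ∀ k : ℕ × ℕ, T₂ (e2 k) = (β k : ℂ) • e2 (k.1, k.2 + 1))
    (hcomm : T₁ * T₂ = T₂ * T₁) (k : ℕ × ℕ) :
    α (k.1, k.2 + 1) * β k = β (k.1 + 1, k.2) * α k := by
  have h := congrArg (fun T : H2 →L[ℂ] H2 => T (e2 k) (k.1 + 1, k.2 + 1)) hcomm
  simp only [ContinuousLinearMap.mul_def, ContinuousLinearMap.comp_apply, hT₁, hT₂, map_smul, smul_smul, ← Complex.ofReal_mul] at h
  simp only [e2, lp.coeFn_smul, Pi.smul_apply, lp.single_apply_self, smul_eq_mul, mul_one,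
    Complex.ofReal_inj] at h
  linarith

theorem rpow_div_mul_rpow_div {a b c : ℝ} (ha : 0 < a) (hb : 0 < b) (hc : 0 < c) (r : ℝ) :
    (b / a) ^ r * (c / b) ^ r = (c / a) ^ r := by
  rw [← Real.mul_rpow (by positivity) (by positivity), mul_comm, div_mul_div_cancel₀ hb.ne']


/-- Proposition 2.1(i)(b): for a commuting 2-variable weighted shift `W_{(α,β)} = (T₁,T₂)`
with positive weights, the spherical Aluthge transform `(S₁,S₂)` (the pair of weighted
shifts with weights `α̂_{k} = α_k (Q_{k+ε₁}/Q_k)^{1/4}` and `β̂_{k} = β_k (Q_{k+ε₂}/Q_k)^{1/4}`,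
where `Q_k = α_k² + β_k²`) is always a commuting pair. -/
theorem spherical_aluthge_always_commuting
    (α β : ℕ × ℕ → ℝ)
    (hα : ∀ k, 0 < α k) (hβ : ∀ k, 0 < β k)
    (T₁ T₂ S₁ S₂ : H2 →L[ℂ] H2)
    (hT₁ : ∀ k : ℕ × ℕ, T₁ (e2 k) = (α k : ℂ) • e2 (k.1 + 1, k.2))
    (hT₂ : ∀ k : ℕ × ℕ, T₂ (e2 k) = (β k : ℂ) • e2 (k.1, k.2 + 1))
    (hcomm : T₁ * T₂ = T₂ * T₁)
    (hS₁ : ∀ k : ℕ × ℕ,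
      S₁ (e2 k) = ((α k *
        (((α (k.1 + 1, k.2)) ^ 2 + (β (k.1 + 1, k.2)) ^ 2) / ((α k) ^ 2 + (β k) ^ 2))
          ^ ((1 : ℝ) / 4) : ℝ) : ℂ) • e2 (k.1 + 1, k.2))
    (hS₂ : ∀ k : ℕ × ℕ,
      S₂ (e2 k) = ((β k *
        (((α (k.1, k.2 + 1)) ^ 2 + (β (k.1, k.2 + 1)) ^ 2) / ((α k) ^ 2 + (β k) ^ 2))
          ^ ((1 : ℝ) / 4) : ℝ) : ℂ) • e2 (k.1, k.2 + 1)) :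
    S₁ * S₂ = S₂ * S₁ := by
  refine ext_e2 fun k => ?_
  have hQ (j : ℕ × ℕ) : 0 < α j ^ 2 + β j ^ 2 := by
    have := hα j
    positivity
  have hw := weights_comm_of_comm hT₁ hT₂ hcomm k
  simp only [ContinuousLinearMap.mul_def, ContinuousLinearMap.comp_apply, hS₁, hS₂, map_smul, smul_smul, ← Complex.ofReal_mul]
  congr 2
  have h₁ := rpow_div_mul_rpow_div (hQ k) (hQ (k.1 + 1, k.2)) (hQ (k.1 + 1, k.2 + 1)) (1 / 4)
  have h₂ := rpow_div_mul_rpow_div (hQ k) (hQ (k.1, k.2 + 1)) (hQ (k.1 + 1, k.2 + 1)) (1 / 4)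
  rw [mul_mul_mul_comm, mul_mul_mul_comm (α k), h₁, h₂, mul_comm (β k), hw, mul_comm (α k)]
end
end

section
/- Let W_{(α,β)} = (T₁,T₂) be a commuting 2-variable weighted shift with positive weights. Then the spherical Aluthge transform equals the toral Aluthge transform (Ŵ_{(α,β)} = W̃_{(α,β)}, i.e., α̂ = α̃ and β̂ = β̃ at every index) if and only if there exist a bounded sequence of positive reals {ωₙ} and a constant c > 0 such that α_{(k₁,k₂)} = ω_{k₁+k₂} and β_{(k₁,k₂)} = c·ω_{k₁+k₂} for all k₁,k₂ ≥ 0. -/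
open scoped ComplexOrder
open MeasureTheory ContinuousLinearMap

noncomputable section

lemma norm_e2 (k : ℕ × ℕ) : ‖e2 k‖ = 1 := by
  simp [e2, lp.norm_single]

lemma e2_ne_zero (k : ℕ × ℕ) : e2 k ≠ 0 := by
  rw [← norm_ne_zero_iff, norm_e2]
  exact one_ne_zero

/-- A weight of a shift with `T (e2 k) = w • e2 l` is bounded by the operator norm. -/
lemma weight_le_opNorm {T : H2 →L[ℂ] H2} {w : ℝ} {k l : ℕ × ℕ}
    (h : T (e2 k) = (w : ℂ) • e2 l) : w ≤ ‖T‖ := by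
  have h1 := T.le_opNorm (e2 k)
  rw [h, norm_smul, norm_e2, norm_e2, mul_one, mul_one, Complex.norm_real] at h1
  exact (le_abs_self w).trans h1

/-- Commuting weighted shifts have compatible weights. -/
lemma weight_comm {α β : ℕ × ℕ → ℝ} {T₁ T₂ : H2 →L[ℂ] H2}
    (hT₁ : ∀ k : ℕ × ℕ, T₁ (e2 k) = (α k : ℂ) • e2 (k.1 + 1, k.2))
    (hT₂ : ∀ k : ℕ × ℕ, T₂ (e2 k) = (β k : ℂ) • e2 (k.1, k.2 + 1))
    (hcomm : T₁ * T₂ = T₂ * T₁) (k : ℕ × ℕ) :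
    β k * α (k.1, k.2 + 1) = α k * β (k.1 + 1, k.2) := by
  have h : T₁ (T₂ (e2 k)) = T₂ (T₁ (e2 k)) := congrArg (fun T : H2 →L[ℂ] H2 => T (e2 k)) hcomm
  rw [hT₂, hT₁, map_smul, map_smul, hT₁, hT₂, smul_smul, smul_smul] at h
  exact_mod_cast smul_left_injective ℂ (e2_ne_zero _) h

/-- The spherical and toral Aluthge weights agree exactly when the ratio of the two weights
is preserved by the shift. -/
lemma aluthge_weight_eq_iff {a b a' b' : ℝ} (ha : 0 < a) (hb : 0 < b) (ha' : 0 < a')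
    (hb' : 0 < b') :
    a * ((a' ^ 2 + b' ^ 2) / (a ^ 2 + b ^ 2)) ^ ((1 : ℝ) / 4) = Real.sqrt (a * a') ↔
      a * b' = a' * b := by
  have hR : 0 ≤ (a' ^ 2 + b' ^ 2) / (a ^ 2 + b ^ 2) := by positivity
  have hroot : (((a' ^ 2 + b' ^ 2) / (a ^ 2 + b ^ 2)) ^ ((1 : ℝ) / 4)) ^ 4
      = (a' ^ 2 + b' ^ 2) / (a ^ 2 + b ^ 2) := by
    rw [← Real.rpow_natCast, ← Real.rpow_mul hR]
    norm_num
  have hsqrt : Real.sqrt (a * a') ^ 4 = (a * a') ^ 2 := by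
    rw [show 4 = 2 * 2 from rfl, pow_mul, Real.sq_sqrt (by positivity)]
  have hQ : a ^ 2 + b ^ 2 ≠ 0 := by positivity
  rw [← pow_left_inj₀ (by positivity) (Real.sqrt_nonneg _) (four_ne_zero : (4 : ℕ) ≠ 0), mul_pow,
    hroot, hsqrt, ← pow_left_inj₀ (a := a * b') (by positivity) (by positivity) two_ne_zero,
    ← mul_div_assoc, div_eq_iff hQ]
  constructor
  · intro h
    have ha2 : a ^ 2 ≠ 0 := by positivity
    apply mul_left_cancel₀ ha2
    linear_combination h
  · intro h
    linear_combination a ^ 2 * h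

/-- Theorem 2.6: for a commuting 2-variable weighted shift `W_{(α,β)} = (T₁,T₂)` with
positive weights, the spherical Aluthge transform equals the toral Aluthge transform
(`α̂ = α̃` and `β̂ = β̃` at every index) if and only if there exist a bounded sequence of
positive reals `ω` and a constant `c > 0` with `α_{(k₁,k₂)} = ω_{k₁+k₂}` and
`β_{(k₁,k₂)} = c · ω_{k₁+k₂}` for all `k₁,k₂`. -/
theorem spherical_eq_toral_iff
    (α β : ℕ × ℕ → ℝ)
    (hα : ∀ k, 0 < α k) (hβ : ∀ k, 0 < β k)
    (T₁ T₂ : H2 →L[ℂ] H2)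
    (hT₁ : ∀ k : ℕ × ℕ, T₁ (e2 k) = (α k : ℂ) • e2 (k.1 + 1, k.2))
    (hT₂ : ∀ k : ℕ × ℕ, T₂ (e2 k) = (β k : ℂ) • e2 (k.1, k.2 + 1))
    (hcomm : T₁ * T₂ = T₂ * T₁) :
    ((∀ k : ℕ × ℕ,
        α k * (((α (k.1 + 1, k.2)) ^ 2 + (β (k.1 + 1, k.2)) ^ 2) / ((α k) ^ 2 + (β k) ^ 2))
            ^ ((1 : ℝ) / 4)
          = Real.sqrt (α k * α (k.1 + 1, k.2)) ∧
        β k * (((α (k.1, k.2 + 1)) ^ 2 + (β (k.1, k.2 + 1)) ^ 2) / ((α k) ^ 2 + (β k) ^ 2))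
            ^ ((1 : ℝ) / 4)
          = Real.sqrt (β k * β (k.1, k.2 + 1))) ↔
      ∃ (ω : ℕ → ℝ) (c : ℝ), 0 < c ∧ (∀ n, 0 < ω n) ∧ (∃ M : ℝ, ∀ n, ω n ≤ M) ∧
        ∀ k : ℕ × ℕ, α k = ω (k.1 + k.2) ∧ β k = c * ω (k.1 + k.2)) := by
  have hw := weight_comm hT₁ hT₂ hcomm
  constructor
  · intro h
    have h₁ (k : ℕ × ℕ) : α k * β (k.1 + 1, k.2) = α (k.1 + 1, k.2) * β k :=
      (aluthge_weight_eq_iff (hα _) (hβ _) (hα _) (hβ _)).1 (h k).1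
    have h₂ (k : ℕ × ℕ) : β k * α (k.1, k.2 + 1) = β (k.1, k.2 + 1) * α k := by
      refine (aluthge_weight_eq_iff (hβ _) (hα _) (hβ _) (hα _)).1 ?_
      rw [← (h k).2, add_comm (β (k.1, k.2 + 1) ^ 2), add_comm (β k ^ 2)]
    have hdiag (k : ℕ × ℕ) : α (k.1, k.2 + 1) = α (k.1 + 1, k.2) := by
      apply mul_left_cancel₀ (hβ k).ne'
      linear_combination hw k + h₁ k
    have hsum (j : ℕ) : ∀ i, α (i, j) = α (i + j, 0) := by
      induction j with
      | zero => intro i; rfl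
      | succ j ih =>
        intro i
        rw [hdiag (i, j), ih, add_right_comm, add_assoc]
    have hrow (i : ℕ) : β (i, 0) = β (0, 0) / α (0, 0) * α (i, 0) := by
      induction i with
      | zero => exact (div_mul_cancel₀ _ (hα _).ne').symm
      | succ i ih =>
        apply mul_left_cancel₀ (hα (i, 0)).ne'
        rw [h₁ (i, 0), ih]
        ring
    have hratio (i j : ℕ) : β (i, j) = β (0, 0) / α (0, 0) * α (i, j) := by
      induction j with
      | zero => exact hrow i
      | succ j ih =>
        apply mul_right_cancel₀ (hα (i, j)).ne'
        rw [← h₂ (i, j), ih]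
        ring
    refine ⟨fun n => α (n, 0), β (0, 0) / α (0, 0), div_pos (hβ _) (hα _), fun n => hα _,
      ⟨‖T₁‖, fun n => weight_le_opNorm (hT₁ (n, 0))⟩, fun ⟨i, j⟩ => ⟨hsum j i, ?_⟩⟩
    exact (hratio i j).trans (congrArg _ (hsum j i))
  · rintro ⟨ω, c, -, -, -, h⟩ k
    constructor
    · refine (aluthge_weight_eq_iff (hα _) (hβ _) (hα _) (hβ _)).2 ?_
      simp only [h]
      ring
    · rw [add_comm (α (k.1, k.2 + 1) ^ 2), add_comm (α k ^ 2)]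
      refine (aluthge_weight_eq_iff (hβ _) (hα _) (hβ _) (hα _)).2 ?_
      simp only [h]
      ring
end
end
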